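/- Let A be any n×d real matrix of rank d with n > d. For each m, let S_m be a k_m × n_m Gaussian sketch (entries independent N(0, 1/k_m)) applied to an n_m × d_m rank-d_m data matrix A_m, where n_m > d_m, d_m → ∞, k_m → ∞, and d_m/k_m → α with α ∈ (0, 1]. Then for every ε > 0 with ε ≠ (1+√α)² − 1, the probability that S_m is an ε-subspace embedding for A_m converges to 0 if ε < (1+√α)² − 1, and converges to 1 if ε > (1+√α)² − 1. -/

import Mathlib

open MeasureTheory ProbabilityTheory Matrix Filter
open scoped ENNReal NNReal

/-- Matrices inherit the product measurable structure. -/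
instance {m n α : Type*} [MeasurableSpace α] : MeasurableSpace (Matrix m n α) :=
  inferInstanceAs (MeasurableSpace (m → n → α))

/-- The law of a `k × n` random matrix with independent `N(0, 1/k)` entries
(the Gaussian sketch of size `k`). -/
noncomputable def gaussianMatrix (k n : ℕ) : Measure (Matrix (Fin k) (Fin n) ℝ) :=
  Measure.pi fun _ : Fin k => Measure.pi fun _ : Fin n => gaussianReal 0 (1 / k)

/-- `S` is an `ε`-subspace embedding for `A` if `(1-ε)‖Az‖² ≤ ‖SAz‖² ≤ (1+ε)‖Az‖²`
for every `z` (Euclidean norms). -/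
def IsSubspaceEmbedding {k n d : ℕ} (S : Matrix (Fin k) (Fin n) ℝ)
    (A : Matrix (Fin n) (Fin d) ℝ) (ε : ℝ) : Prop :=
  ∀ z : Fin d → ℝ,
    (1 - ε) * (∑ i, (A.mulVec z i) ^ 2) ≤ (∑ i, ((S * A).mulVec z i) ^ 2) ∧
    (∑ i, ((S * A).mulVec z i) ^ 2) ≤ (1 + ε) * (∑ i, (A.mulVec z i) ^ 2)

/-- The law of a `k × d` random matrix with independent standard normal entries. -/
noncomputable def stdGaussianMatrix (k d : ℕ) : Measure (Matrix (Fin k) (Fin d) ℝ) :=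
  Measure.pi fun _ : Fin k => Measure.pi fun _ : Fin d => gaussianReal 0 1

instance (k d : ℕ) : IsProbabilityMeasure (stdGaussianMatrix k d) :=
  inferInstanceAs (IsProbabilityMeasure
    (Measure.pi fun _ : Fin k => Measure.pi fun _ : Fin d => gaussianReal 0 1))

instance (k n : ℕ) : IsProbabilityMeasure (gaussianMatrix k n) :=
  inferInstanceAs (IsProbabilityMeasure
    (Measure.pi fun _ : Fin k => Measure.pi fun _ : Fin n => gaussianReal 0 (1 / k)))

instance (k d : ℕ) : BorelSpace (Matrix (Fin k) (Fin d) ℝ) :=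
  inferInstanceAs (BorelSpace (Fin k → Fin d → ℝ))

section ChiSquare

lemma exp_mul_sq_gaussian {t : ℝ} (ht : t < 1 / 2) :
    Integrable (fun x => Real.exp (t * x ^ 2)) (gaussianReal 0 1) ∧
      ∫ x, Real.exp (t * x ^ 2) ∂gaussianReal 0 1 = (√(1 - 2 * t))⁻¹ := by
  have hpdf : ∀ x : ℝ, gaussianPDFReal 0 1 x • Real.exp (t * x ^ 2) =
      (√(2 * Real.pi))⁻¹ * Real.exp (-(1 / 2 - t) * x ^ 2) := by
    intro x
    simp only [gaussianPDFReal, smul_eq_mul, NNReal.coe_one, mul_one, sub_zero, mul_assoc]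
    rw [← Real.exp_add]
    congr 2
    ring
  constructor
  · rw [gaussianReal_of_var_ne_zero _ one_ne_zero,
      integrable_withDensity_iff_integrable_smul' (measurable_gaussianPDF _ _)
        (ae_of_all _ fun _ => gaussianPDF_lt_top)]
    simp only [toReal_gaussianPDF, hpdf]
    exact (integrable_exp_neg_mul_sq (by linarith)).const_mul _
  · rw [integral_gaussianReal_eq_integral_smul one_ne_zero]
    simp only [hpdf]
    rw [integral_const_mul, integral_gaussian, ← Real.sqrt_inv, ← Real.sqrt_mul (by positivity),
      ← Real.sqrt_inv]
    congr 1
    have : 1 / 2 - t ≠ 0 := by linarith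
    have : 1 - 2 * t ≠ 0 := by linarith
    have := Real.pi_pos.ne'
    field_simp

lemma inv_sqrt_one_sub_le {t : ℝ} (ht : |t| ≤ 1 / 4) :
    (√(1 - 2 * t))⁻¹ ≤ Real.exp (t + 4 * t ^ 2) := by
  have h := abs_le.mp ht
  have h2 : |2 * t| ≤ 1 / 2 := by rw [abs_mul]; norm_num; linarith
  have hlog := Real.abs_log_sub_add_sum_range_le (x := 2 * t) (by linarith) 1
  simp only [Finset.sum_range_one, zero_add, pow_one, Nat.cast_zero, div_one] at hlog
  have hb : |2 * t| ^ (1 + 1) / (1 - |2 * t|) ≤ 8 * t ^ 2 := by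
    rw [div_le_iff₀ (by linarith), sq_abs]
    nlinarith [sq_nonneg t]
  have h3 := (abs_le.mp (hlog.trans hb)).1
  have hpos : 0 < 1 - 2 * t := by linarith
  rw [← Real.sqrt_inv]
  apply Real.sqrt_le_iff.mpr ⟨(Real.exp_pos _).le, ?_⟩
  rw [← Real.exp_nat_mul, ← Real.exp_log (inv_pos.mpr hpos), Real.log_inv]
  apply Real.exp_le_exp.mpr
  push_cast
  linarith

lemma mgf_dotProduct_self (j : ℕ) {t : ℝ} (ht : |t| ≤ 1 / 4) :
    Integrable (fun g : Fin j → ℝ => Real.exp (t * (g ⬝ᵥ g)))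
        (Measure.pi fun _ => gaussianReal 0 1) ∧
      mgf (fun g : Fin j → ℝ => g ⬝ᵥ g) (Measure.pi fun _ => gaussianReal 0 1) t ≤
        Real.exp (j * (t + 4 * t ^ 2)) := by
  have h := abs_le.mp ht
  have hg := exp_mul_sq_gaussian (t := t) (by linarith)
  have he : (fun g : Fin j → ℝ => Real.exp (t * (g ⬝ᵥ g))) =
      fun g => ∏ i, Real.exp (t * g i ^ 2) := by
    ext g
    rw [← Real.exp_sum, dotProduct, Finset.mul_sum]
    simp only [sq]
  constructor
  · rw [he]
    exact Integrable.fintype_prod (f := fun _ x => Real.exp (t * x ^ 2)) fun _ => hg.1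
  · rw [mgf, he, integral_fintype_prod_eq_pow (fun x => Real.exp (t * x ^ 2)), hg.2,
      Fintype.card_fin, Real.exp_nat_mul]
    exact pow_le_pow_left₀ (by positivity) (inv_sqrt_one_sub_le ht) j

lemma dotProduct_self_concentration {δ : ℝ} (hδ : 0 < δ) (hδ1 : δ ≤ 1) {j N : ℕ} (hj : j ≤ N) :
    (Measure.pi fun _ : Fin j => gaussianReal 0 1) {g | δ * N < |g ⬝ᵥ g - j|} ≤
      ENNReal.ofReal (2 * Real.exp (-(δ ^ 2 / 16) * N)) := by
  set μ := Measure.pi fun _ : Fin j => gaussianReal 0 1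
  have hjN : (j : ℝ) ≤ N := by exact_mod_cast hj
  have ht : |δ / 8| ≤ 1 / 4 := by rw [abs_of_pos (by linarith)]; linarith
  have ht' : |-(δ / 8)| ≤ 1 / 4 := by rwa [abs_neg]
  have hup := (measure_ge_le_exp_mul_mgf (μ := μ) (X := fun g : Fin j → ℝ => g ⬝ᵥ g)
    (j + δ * N) (by linarith : 0 ≤ δ / 8) (mgf_dotProduct_self j ht).1).trans
    (mul_le_mul_of_nonneg_left (mgf_dotProduct_self j ht).2 (Real.exp_pos _).le)
  have hlo := (measure_le_le_exp_mul_mgf (μ := μ) (X := fun g : Fin j → ℝ => g ⬝ᵥ g)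
    (j - δ * N) (by linarith : -(δ / 8) ≤ 0) (mgf_dotProduct_self j ht').1).trans
    (mul_le_mul_of_nonneg_left (mgf_dotProduct_self j ht').2 (Real.exp_pos _).le)
  rw [← Real.exp_add] at hup hlo
  have hsub : {g : Fin j → ℝ | δ * N < |g ⬝ᵥ g - j|} ⊆
      {g | j + δ * N ≤ g ⬝ᵥ g} ∪ {g | g ⬝ᵥ g ≤ j - δ * N} := by
    intro g hg
    rcases lt_abs.mp (Set.mem_ofPred.mp hg) with h | h
    · left; simp only [Set.mem_ofPred_eq]; linarith
    · right; simp only [Set.mem_ofPred_eq]; linarith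
  have hδj := mul_le_mul_of_nonneg_left hjN (sq_nonneg δ)
  have h1 : μ.real {g : Fin j → ℝ | δ * N < |g ⬝ᵥ g - j|} ≤ 2 * Real.exp (-(δ ^ 2 / 16) * N) := by
    refine (measureReal_mono hsub).trans ((measureReal_union_le _ _).trans ?_)
    rw [two_mul]
    refine add_le_add (hup.trans (Real.exp_le_exp.mpr ?_)) (hlo.trans (Real.exp_le_exp.mpr ?_))
    · nlinarith
    · nlinarith
  rw [← ofReal_measureReal]
  exact ENNReal.ofReal_le_ofReal h1

end ChiSquare

section Invariance

lemma measurePreserving_transpose (k d : ℕ) :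
    MeasurePreserving (transpose : Matrix (Fin k) (Fin d) ℝ → Matrix (Fin d) (Fin k) ℝ)
      (stdGaussianMatrix k d) (stdGaussianMatrix d k) := by
  have hm : Measurable
      (transpose : Matrix (Fin k) (Fin d) ℝ → Matrix (Fin d) (Fin k) ℝ) :=
    (continuous_id.matrix_transpose).measurable
  refine ⟨hm, ?_⟩
  unfold stdGaussianMatrix
  symm
  refine Measure.pi_eq_generateFrom
    (C := fun _ => Set.pi Set.univ '' Set.pi Set.univ fun _ => {s : Set ℝ | MeasurableSet s})
    (fun _ => generateFrom_pi) (fun _ => isPiSystem_pi)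
    (fun _ => Measure.FiniteSpanningSetsIn.pi fun _ => Measure.toFiniteSpanningSetsIn _) ?_
  intro s hs
  choose t ht hts using hs
  obtain rfl : s = fun i => Set.pi Set.univ (t i) := funext fun i => (hts i).symm
  refine (Measure.map_apply (μ := stdGaussianMatrix k d) hm (MeasurableSet.univ_pi fun i =>
    MeasurableSet.univ_pi fun j => ht i j trivial)).trans ?_
  have : (transpose : Matrix (Fin k) (Fin d) ℝ → Matrix (Fin d) (Fin k) ℝ) ⁻¹'
      (Set.pi Set.univ fun i => Set.pi Set.univ (t i)) =
      (Set.pi Set.univ fun j => Set.pi Set.univ fun i => t i j) := by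
    ext G
    exact ⟨fun h j _ i _ => h i trivial j trivial, fun h i _ j _ => h j trivial i trivial⟩
  rw [this]
  refine (Measure.pi_pi _ _).trans ?_
  simp only [Measure.pi_pi]
  exact Finset.prod_comm

lemma measurePreserving_vecMul {n d : ℕ} (O : Matrix (Fin n) (Fin d) ℝ) (hO : Oᵀ * O = 1) :
    MeasurePreserving (fun r : Fin n → ℝ => r ᵥ* O)
      (Measure.pi fun _ => gaussianReal 0 1) (Measure.pi fun _ => gaussianReal 0 1) := by
  have hm : Measurable (fun r : Fin n → ℝ => r ᵥ* O) :=
    (continuous_id.matrix_vecMul continuous_const).measurable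
  refine ⟨hm, ?_⟩
  have hinj : Function.Injective (fun μ : Measure (Fin d → ℝ) => μ.map (WithLp.toLp 2)) :=
    (MeasurableEquiv.toLp 2 (Fin d → ℝ)).map_measurableEquiv_injective
  apply hinj
  simp only
  have := isProbabilityMeasure_stdGaussian (E := EuclideanSpace ℝ (Fin d))
  rw [map_pi_eq_stdGaussian, Measure.map_map (by fun_prop) hm]
  have hP : IsProbabilityMeasure ((Measure.pi fun _ : Fin n => gaussianReal 0 1).map
      (WithLp.toLp 2 ∘ fun r : Fin n → ℝ => r ᵥ* O)) :=
    Measure.isProbabilityMeasure_map (by fun_prop)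
  apply Measure.ext_of_charFun
  ext t
  have h1 := charFun_stdGaussian (E := EuclideanSpace ℝ (Fin n)) (WithLp.toLp 2 (O *ᵥ t.ofLp))
  rw [← map_pi_eq_stdGaussian, charFun_apply, integral_map (by fun_prop) (by fun_prop)] at h1
  rw [charFun_stdGaussian, charFun_apply, integral_map (by fun_prop) (by fun_prop)]
  have hn : ‖WithLp.toLp 2 (O *ᵥ t.ofLp)‖ ^ 2 = ‖t‖ ^ 2 := by
    rw [EuclideanSpace.real_norm_sq_eq, EuclideanSpace.real_norm_sq_eq]
    have : (O *ᵥ t.ofLp) ⬝ᵥ (O *ᵥ t.ofLp) = t.ofLp ⬝ᵥ t.ofLp := by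
      rw [dotProduct_mulVec, vecMul_mulVec, hO, vecMul_one]
    simpa only [dotProduct, ← sq] using this
  rw [← Complex.ofReal_pow, hn, Complex.ofReal_pow] at h1
  rw [← h1]
  congr 1
  ext r
  congr 3
  simp only [Function.comp, EuclideanSpace.inner_eq_star_dotProduct,
    star_trivial]
  rw [dotProduct_comm, ← dotProduct_mulVec, dotProduct_comm]

end Invariance
section Decomposition

lemma measurePreserving_mul_right (k : ℕ) {n d : ℕ} (O : Matrix (Fin n) (Fin d) ℝ)
    (hO : Oᵀ * O = 1) :
    MeasurePreserving (fun S : Matrix (Fin k) (Fin n) ℝ => S * O)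
      (stdGaussianMatrix k n) (stdGaussianMatrix k d) :=
  measurePreserving_pi (fun _ : Fin k => Measure.pi fun _ : Fin n => gaussianReal 0 1)
    (fun _ : Fin k => Measure.pi fun _ : Fin d => gaussianReal 0 1)
    fun _ => measurePreserving_vecMul O hO

lemma measurePreserving_mul_left {k d : ℕ} (U : Matrix (Fin k) (Fin k) ℝ)
    (hU : Uᵀ * U = 1) :
    MeasurePreserving (fun G : Matrix (Fin k) (Fin d) ℝ => U * G)
      (stdGaussianMatrix k d) (stdGaussianMatrix k d) := by
  have hU' : Uᵀᵀ * Uᵀ = 1 := by rw [transpose_transpose, mul_eq_one_comm.mp hU]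
  have h := (measurePreserving_transpose d k).comp
    ((measurePreserving_mul_right d Uᵀ hU').comp (measurePreserving_transpose k d))
  convert h using 1
  ext G : 1
  simp [transpose_mul]

/-- Adjoin a first row to a matrix. -/
def consRow {k d : ℕ} (h : Fin d → ℝ) (G : Matrix (Fin k) (Fin d) ℝ) :
    Matrix (Fin (k + 1)) (Fin d) ℝ :=
  of (Fin.cases h G)

@[simp]
lemma consRow_zero {k d : ℕ} (h : Fin d → ℝ) (G : Matrix (Fin k) (Fin d) ℝ) (j : Fin d) :
    consRow h G 0 j = h j := rfl

@[simp]
lemma consRow_succ {k d : ℕ} (h : Fin d → ℝ) (G : Matrix (Fin k) (Fin d) ℝ) (i : Fin k)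
    (j : Fin d) : consRow h G i.succ j = G i j := rfl

/-- Adjoin a first column to a matrix. -/
def consCol {k d : ℕ} (g : Fin k → ℝ) (G : Matrix (Fin k) (Fin d) ℝ) :
    Matrix (Fin k) (Fin (d + 1)) ℝ :=
  (consRow g Gᵀ)ᵀ

@[simp]
lemma consCol_zero {k d : ℕ} (g : Fin k → ℝ) (G : Matrix (Fin k) (Fin d) ℝ) (i : Fin k) :
    consCol g G i 0 = g i := rfl

@[simp]
lemma consCol_succ {k d : ℕ} (g : Fin k → ℝ) (G : Matrix (Fin k) (Fin d) ℝ) (i : Fin k)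
    (j : Fin d) : consCol g G i j.succ = G i j := rfl

lemma measurePreserving_consRow (k d : ℕ) :
    MeasurePreserving (fun p : (Fin d → ℝ) × Matrix (Fin k) (Fin d) ℝ => consRow p.1 p.2)
      ((Measure.pi fun _ => gaussianReal 0 1).prod (stdGaussianMatrix k d))
      (stdGaussianMatrix (k + 1) d) := by
  have h := (measurePreserving_piFinSuccAbove (fun _ : Fin (k + 1) =>
    (Measure.pi fun _ : Fin d => gaussianReal 0 1)) 0).symm
  have he : (fun p : (Fin d → ℝ) × Matrix (Fin k) (Fin d) ℝ => consRow p.1 p.2) =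
      (MeasurableEquiv.piFinSuccAbove (fun _ : Fin (k + 1) => Fin d → ℝ) 0).symm := by
    funext p i
    exact Fin.cases rfl (fun _ => rfl) i
  rw [he]
  exact h

lemma measurePreserving_consCol (k d : ℕ) :
    MeasurePreserving (fun p : (Fin k → ℝ) × Matrix (Fin k) (Fin d) ℝ => consCol p.1 p.2)
      ((Measure.pi fun _ => gaussianReal 0 1).prod (stdGaussianMatrix k d))
      (stdGaussianMatrix k (d + 1)) :=
  (measurePreserving_transpose (d + 1) k).comp ((measurePreserving_consRow d k).comp
    ((MeasurePreserving.id _).prod (measurePreserving_transpose k d)))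

lemma prod_apply_le_add {X Y : Type*} [MeasurableSpace X] [MeasurableSpace Y]
    {μ : Measure X} {ν : Measure Y} [IsProbabilityMeasure μ] [IsProbabilityMeasure ν]
    {s : Set (X × Y)} (hs : MeasurableSet s) (b : Set X) {p : ℝ≥0∞}
    (h : ∀ x ∉ b, ν (Prod.mk x ⁻¹' s) ≤ p) : μ.prod ν s ≤ μ b + p := by
  rw [Measure.prod_apply hs]
  calc ∫⁻ x, ν (Prod.mk x ⁻¹' s) ∂μ ≤ ∫⁻ x, (b.indicator 1 x + p) ∂μ := by
        refine lintegral_mono fun x => ?_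
        by_cases hx : x ∈ b
        · simp only [hx, Set.indicator_of_mem, Pi.one_apply]
          exact prob_le_one.trans le_self_add
        · simpa [hx] using h x hx
    _ ≤ μ b + p := by
        rw [lintegral_add_right _ measurable_const, lintegral_const, measure_univ, mul_one]
        gcongr
        exact lintegral_indicator_one_le b

lemma exists_orthogonal_mulVec_eq {k : ℕ} (g : Fin (k + 1) → ℝ) :
    ∃ U : Matrix (Fin (k + 1)) (Fin (k + 1)) ℝ, Uᵀ * U = 1 ∧
      U *ᵥ g = Pi.single 0 √(g ⬝ᵥ g) := by
  set e : Fin (k + 1) → ℝ := Pi.single 0 √(g ⬝ᵥ g) with he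
  set v := g - e with hv
  have hgg : 0 ≤ g ⬝ᵥ g := by simpa using dotProduct_self_star_nonneg g
  have hee : e ⬝ᵥ e = g ⬝ᵥ g := by simp [he, Real.mul_self_sqrt hgg]
  have hvv : v ⬝ᵥ v = 2 * (v ⬝ᵥ g) := by
    simp only [hv, sub_dotProduct, dotProduct_sub, hee, dotProduct_comm g e]
    ring
  by_cases h0 : v ⬝ᵥ v = 0
  · refine ⟨1, by simp, ?_⟩
    rw [dotProduct_self_eq_zero] at h0
    rw [one_mulVec]
    exact sub_eq_zero.mp h0
  · refine ⟨1 - (2 / (v ⬝ᵥ v)) • vecMulVec v v, ?_, ?_⟩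
    · rw [transpose_sub, transpose_one, transpose_smul, transpose_vecMulVec, mul_sub, sub_mul,
        sub_mul, smul_mul_smul_comm, vecMulVec_mul_vecMulVec, one_mul, mul_one]
      ext i j
      simp [vecMulVec_apply]
      field_simp
      ring
    · rw [sub_mulVec, one_mulVec, smul_mulVec, vecMulVec_mulVec]
      have : (2 / (v ⬝ᵥ v)) * (v ⬝ᵥ g) = 1 := by
        have h1 : v ⬝ᵥ g ≠ 0 := fun h => h0 (by rw [hvv, h, mul_zero])
        rw [hvv]
        field_simp
      simp only [op_smul_eq_smul, smul_smul, this, one_smul]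
      simp [hv]

lemma mul_consCol {k d : ℕ} (U : Matrix (Fin k) (Fin k) ℝ) (g : Fin k → ℝ)
    (G : Matrix (Fin k) (Fin d) ℝ) : U * consCol g G = consCol (U *ᵥ g) (U * G) := by
  ext i j
  refine Fin.cases ?_ (fun j => ?_) j <;>
    simp [mul_apply, mulVec, dotProduct]

/-- One step of Householder bidiagonalization: a rotation invariant event for a Gaussian matrix
is estimated by fixing the lengths of the first column and of the remaining first row. -/
lemma measure_le_of_bidiagonal_step {k d : ℕ} {B : Set (Matrix (Fin (k + 1)) (Fin (d + 1)) ℝ)}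
    (hB : MeasurableSet B)
    (hinv : ∀ U : Matrix (Fin (k + 1)) (Fin (k + 1)) ℝ, Uᵀ * U = 1 → ∀ G ∈ B, U * G ∈ B)
    (b₁ : Set (Fin (k + 1) → ℝ)) (b₂ : Set (Fin d → ℝ)) {p : ℝ≥0∞}
    (h : ∀ g ∉ b₁, ∀ r ∉ b₂, stdGaussianMatrix k d
      {G | consCol (Pi.single 0 √(g ⬝ᵥ g)) (consRow r G) ∈ B} ≤ p) :
    stdGaussianMatrix (k + 1) (d + 1) B ≤
      (Measure.pi fun _ => gaussianReal 0 1) b₁ +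
        ((Measure.pi fun _ => gaussianReal 0 1) b₂ + p) := by
  have hc := measurePreserving_consCol (k + 1) d
  rw [← hc.measure_preimage hB.nullMeasurableSet]
  refine prod_apply_le_add (hc.measurable hB) b₁ fun g hg => ?_
  obtain ⟨U, hU, hUg⟩ := exists_orthogonal_mulVec_eq g
  have hcol : Measurable fun G : Matrix (Fin (k + 1)) (Fin d) ℝ =>
      consCol (Pi.single 0 √(g ⬝ᵥ g)) G :=
    hc.measurable.comp measurable_prodMk_left
  have hU' := measurePreserving_mul_left (d := d) U hU
  have hr := measurePreserving_consRow k d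
  calc stdGaussianMatrix (k + 1) d {G | consCol g G ∈ B}
      ≤ stdGaussianMatrix (k + 1) d ((fun G => U * G) ⁻¹'
          {G | consCol (Pi.single 0 √(g ⬝ᵥ g)) G ∈ B}) := by
        refine measure_mono fun G hG => ?_
        have := hinv U hU _ hG
        rwa [mul_consCol, hUg] at this
    _ = stdGaussianMatrix (k + 1) d {G | consCol (Pi.single 0 √(g ⬝ᵥ g)) G ∈ B} :=
        hU'.measure_preimage (hcol hB).nullMeasurableSet
    _ ≤ _ := by
        refine (hr.measure_preimage (hcol hB).nullMeasurableSet).symm.trans_le ?_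
        exact prod_apply_le_add (hr.measurable (hcol hB)) b₂ fun r hr' => h g hg r hr'

lemma mulVec_consCol_consRow {k d : ℕ} (a : ℝ) (r : Fin d → ℝ) (G : Matrix (Fin k) (Fin d) ℝ)
    (x : ℝ) (y : Fin d → ℝ) :
    let v := consCol (Pi.single 0 a) (consRow r G) *ᵥ (Fin.cons x y : Fin (d + 1) → ℝ)
    v ⬝ᵥ v = (a * x + r ⬝ᵥ y) ^ 2 + (G *ᵥ y) ⬝ᵥ (G *ᵥ y) := by
  simp only [dotProduct, mulVec, Fin.sum_univ_succ, consCol_zero, consCol_succ,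
    consRow_zero, consRow_succ, Fin.cons_zero, Fin.cons_succ, Pi.single_eq_same, ne_eq, Fin.succ_ne_zero, not_false_eq_true,
    Pi.single_eq_of_ne, zero_mul, zero_add]
  ring

lemma cons_dotProduct_self {d : ℕ} (x : ℝ) (y : Fin d → ℝ) :
    (Fin.cons x y : Fin (d + 1) → ℝ) ⬝ᵥ (Fin.cons x y : Fin (d + 1) → ℝ) = x ^ 2 + y ⬝ᵥ y := by
  simp [dotProduct, Fin.sum_univ_succ, sq]

lemma mulVec_dotProduct_mulVec_of_orthogonal {m n : ℕ} {O : Matrix (Fin m) (Fin n) ℝ}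
    (hO : Oᵀ * O = 1) (x y : Fin n → ℝ) : (O *ᵥ x) ⬝ᵥ (O *ᵥ y) = x ⬝ᵥ y := by
  rw [dotProduct_mulVec, vecMul_mulVec, hO, vecMul_one]

end Decomposition
section SpectralBounds

/-- The matrices violating `|‖Gz‖² - K‖z‖²| ≤ M‖z‖² - c⟨e,z⟩²` for some `z`. -/
def deviationSet {k d : ℕ} (K M c : ℝ) (e : Fin d → ℝ) : Set (Matrix (Fin k) (Fin d) ℝ) :=
  {G | ∃ z, M * (z ⬝ᵥ z) - c * (e ⬝ᵥ z) ^ 2 < |(G *ᵥ z) ⬝ᵥ (G *ᵥ z) - K * (z ⬝ᵥ z)|}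

lemma continuous_mulVec_dotProduct {k d : ℕ} (z : Fin d → ℝ) :
    Continuous fun G : Matrix (Fin k) (Fin d) ℝ => (G *ᵥ z) ⬝ᵥ (G *ᵥ z) :=
  (continuous_id.matrix_mulVec continuous_const).dotProduct
    (continuous_id.matrix_mulVec continuous_const)

lemma measurableSet_deviationSet {k d : ℕ} (K M c : ℝ) (e : Fin d → ℝ) :
    MeasurableSet (deviationSet K M c e : Set (Matrix (Fin k) (Fin d) ℝ)) := by
  have : (deviationSet K M c e : Set (Matrix (Fin k) (Fin d) ℝ)) = ⋃ z : Fin d → ℝ,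
      {G | M * (z ⬝ᵥ z) - c * (e ⬝ᵥ z) ^ 2 < |(G *ᵥ z) ⬝ᵥ (G *ᵥ z) - K * (z ⬝ᵥ z)|} := by
    ext G
    simp [deviationSet]
  rw [this]
  exact (isOpen_iUnion fun z => isOpen_lt continuous_const
    ((continuous_mulVec_dotProduct z).sub continuous_const).abs).measurableSet

lemma zero_le_dotProduct_self {d : ℕ} (z : Fin d → ℝ) : 0 ≤ z ⬝ᵥ z := by
  simpa using dotProduct_self_star_nonneg z

lemma dotProduct_sq_le {d : ℕ} (e z : Fin d → ℝ) : (e ⬝ᵥ z) ^ 2 ≤ (e ⬝ᵥ e) * (z ⬝ᵥ z) := by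
  simpa only [dotProduct, sq] using Finset.sum_mul_sq_le_sq_mul_sq Finset.univ e z

lemma dotProduct_eq_sqrt_mul {d : ℕ} (r y : Fin d → ℝ) :
    r ⬝ᵥ y = √(r ⬝ᵥ r) * (((√(r ⬝ᵥ r))⁻¹ • r) ⬝ᵥ y) := by
  by_cases h : r ⬝ᵥ r = 0
  · simp [dotProduct_self_eq_zero.mp h]
  · have : √(r ⬝ᵥ r) ≠ 0 :=
      Real.sqrt_ne_zero'.mpr (lt_of_le_of_ne (zero_le_dotProduct_self r) (Ne.symm h))
    rw [smul_dotProduct, smul_eq_mul, mul_inv_cancel_left₀ this]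

lemma inv_sqrt_smul_dotProduct_self {d : ℕ} {r : Fin d → ℝ} (h : r ⬝ᵥ r ≠ 0) :
    ((√(r ⬝ᵥ r))⁻¹ • r) ⬝ᵥ ((√(r ⬝ᵥ r))⁻¹ • r) = 1 := by
  rw [smul_dotProduct, dotProduct_smul, smul_eq_mul, smul_eq_mul, ← mul_assoc, ← mul_inv,
    Real.mul_self_sqrt (zero_le_dotProduct_self r), inv_mul_cancel₀ h]

lemma inv_sqrt_smul_dotProduct_self_le {d : ℕ} (r : Fin d → ℝ) :
    ((√(r ⬝ᵥ r))⁻¹ • r) ⬝ᵥ ((√(r ⬝ᵥ r))⁻¹ • r) ≤ 1 := by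
  by_cases h : r ⬝ᵥ r = 0
  · simp [dotProduct_self_eq_zero.mp h]
  · exact (inv_sqrt_smul_dotProduct_self h).le

lemma measure_rotate_le {k d : ℕ} {B B' : Set (Matrix (Fin k) (Fin d) ℝ)} (hB : MeasurableSet B)
    (U : Matrix (Fin d) (Fin d) ℝ) (hU : Uᵀ * U = 1) (h : ∀ G, G * U ∈ B → G ∈ B') :
    stdGaussianMatrix k d B ≤ stdGaussianMatrix k d B' := by
  rw [← (measurePreserving_mul_right k U hU).measure_preimage hB.nullMeasurableSet]
  exact measure_mono h

lemma measure_deviationSet_le {K M P D η : ℝ} {N : ℕ} {τ : ℝ≥0∞} (hη : 0 ≤ η) (hP : 0 ≤ P)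
    (hPsq : (K + η) * (D + η) ≤ P ^ 2) (hM : D + 2 * η + 2 * P ≤ M)
    (hτ : ∀ j ≤ N, (Measure.pi fun _ : Fin j => gaussianReal 0 1) {g | η < |g ⬝ᵥ g - j|} ≤ τ) :
    ∀ (d k : ℕ), d ≤ N → k ≤ N → (d : ℝ) ≤ D → (K + d = D + k) →
      ∀ e : Fin d → ℝ, e ⬝ᵥ e ≤ 1 →
        stdGaussianMatrix k d (deviationSet K M (P + η + d) e) ≤ d * (2 * τ) := by
  intro d
  induction d with
  | zero =>
    intro k _ _ _ _ e _
    have : (deviationSet K M (P + η + (0 : ℕ)) e : Set (Matrix (Fin k) (Fin 0) ℝ)) = ∅ := by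
      ext G
      simp [deviationSet]
    rw [this]
    simp
  | succ d ih =>
    intro k hd hk hD hKD e he
    push_cast at hD hKD
    rcases k with _ | k
    · have : (deviationSet K M (P + η + (d + 1 : ℕ)) e :
          Set (Matrix (Fin 0) (Fin (d + 1)) ℝ)) = ∅ := by
        rw [Set.eq_empty_iff_forall_notMem]
        rintro G ⟨z, hz⟩
        have hz0 := zero_le_dotProduct_self z
        have h1 : (e ⬝ᵥ z) ^ 2 ≤ z ⬝ᵥ z :=
          (dotProduct_sq_le e z).trans (mul_le_of_le_one_left hz0 he)
        have hd0 : (0 : ℝ) ≤ d := Nat.cast_nonneg d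
        have hK : 0 ≤ K := by push_cast at hKD; linarith
        simp only [dotProduct_of_isEmpty, zero_sub, abs_neg] at hz
        rw [abs_of_nonneg (mul_nonneg hK hz0)] at hz
        push_cast at hz hKD
        have h2 := mul_le_mul_of_nonneg_left h1 (by linarith : 0 ≤ P + η + (d + 1))
        have h3 := mul_le_mul_of_nonneg_right hM hz0
        nlinarith [mul_nonneg hη hz0, mul_nonneg hP hz0]
      rw [this]
      simp
    · push_cast at hKD
      set c : ℝ := P + η + (d + 1 : ℕ) with hc
      have hc0 : 0 ≤ c := by positivity
      obtain ⟨U, hU, hUe⟩ := exists_orthogonal_mulVec_eq e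
      calc stdGaussianMatrix (k + 1) (d + 1) (deviationSet K M c e)
          ≤ stdGaussianMatrix (k + 1) (d + 1) (deviationSet K M c (Pi.single 0 1)) := by
            refine measure_rotate_le (measurableSet_deviationSet _ _ _ _) U hU ?_
            rintro G ⟨z, hz⟩
            refine ⟨U *ᵥ z, ?_⟩
            rw [mulVec_mulVec, mulVec_dotProduct_mulVec_of_orthogonal hU]
            refine lt_of_le_of_lt ?_ hz
            have : e ⬝ᵥ z = √(e ⬝ᵥ e) * (U *ᵥ z) 0 := by
              rw [← mulVec_dotProduct_mulVec_of_orthogonal hU, hUe, single_dotProduct]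
            rw [this, mul_pow, Real.sq_sqrt (zero_le_dotProduct_self e), single_dotProduct, one_mul]
            have := mul_le_mul_of_nonneg_right he (sq_nonneg ((U *ᵥ z) 0))
            nlinarith
        _ ≤ _ := measure_le_of_bidiagonal_step (measurableSet_deviationSet _ _ _ _) ?_
            {g | η < |g ⬝ᵥ g - (k + 1 : ℕ)|} {r | η < |r ⬝ᵥ r - d|} (p := d * (2 * τ)) ?_
        _ ≤ τ + (τ + d * (2 * τ)) := by
            gcongr
            · exact hτ _ hk
            · exact hτ _ (by omega)
        _ = ((d + 1 : ℕ) : ℝ≥0∞) * (2 * τ) := by push_cast; ring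
      · rintro V hV G ⟨z, hz⟩
        refine ⟨z, ?_⟩
        rwa [← mulVec_mulVec, mulVec_dotProduct_mulVec_of_orthogonal hV]
      · intro g hg r hr
        simp only [Set.mem_ofPred_eq, not_lt] at hg hr
        refine le_trans (measure_mono ?_) (ih k (by omega) (by omega) (by linarith)
          (by linarith) _ (inv_sqrt_smul_dotProduct_self_le r))
        rintro G ⟨z, hz⟩
        obtain ⟨x, y, rfl⟩ : ∃ x y, z = (Fin.cons x y : Fin (d + 1) → ℝ) :=
          ⟨z 0, Fin.tail z, (Fin.cons_self_tail z).symm⟩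
        refine ⟨y, ?_⟩
        rw [mulVec_consCol_consRow, cons_dotProduct_self, dotProduct_eq_sqrt_mul r y,
          single_dotProduct, one_mul, Fin.cons_zero] at hz
        set a := √(g ⬝ᵥ g)
        set b := √(r ⬝ᵥ r)
        set w := (b⁻¹ • r) ⬝ᵥ y
        have ha0 : 0 ≤ a := Real.sqrt_nonneg _
        have hb0 : 0 ≤ b := Real.sqrt_nonneg _
        rw [← Real.sq_sqrt (zero_le_dotProduct_self g)] at hg
        rw [← Real.sq_sqrt (zero_le_dotProduct_self r)] at hr
        change |a ^ 2 - _| ≤ η at hg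
        change |b ^ 2 - _| ≤ η at hr
        rw [abs_le] at hg hr
        push_cast at hg hr hc
        have hab : a * b ≤ P := by
          refine abs_le_of_sq_le_sq' ?_ hP |>.2
          rw [mul_pow]
          exact (mul_le_mul (by linarith) (by linarith) (sq_nonneg b) (by linarith)).trans hPsq
        have hxw : |2 * (a * b) * (x * w)| ≤ P * (x ^ 2 + w ^ 2) := by
          rw [abs_mul, abs_of_nonneg (by positivity)]
          have : 2 * |x * w| ≤ x ^ 2 + w ^ 2 := by
            rw [abs_mul, ← sq_abs x, ← sq_abs w]
            nlinarith [sq_nonneg (|x| - |w|)]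
          calc 2 * (a * b) * |x * w| = (a * b) * (2 * |x * w|) := by ring
            _ ≤ _ := mul_le_mul hab this (by positivity) hP
        have hak : |(a ^ 2 - K) * x ^ 2| ≤ (D - d - 1 + η) * x ^ 2 := by
          rw [abs_mul, abs_of_nonneg (sq_nonneg x)]
          refine mul_le_mul_of_nonneg_right (abs_le.mpr ⟨?_, ?_⟩) (sq_nonneg x) <;> linarith
        by_contra hcon
        rw [not_lt] at hcon
        have hbw := mul_le_mul_of_nonneg_right (by linarith : b ^ 2 ≤ d + η) (sq_nonneg w)
        have hMx := mul_le_mul_of_nonneg_right hM (sq_nonneg x)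
        rw [hc] at hz
        rw [abs_le] at hxw hak hcon
        rcases lt_abs.mp hz with h | h
        · nlinarith
        · nlinarith [mul_nonneg (sq_nonneg b) (sq_nonneg w)]

lemma measure_forall_le_le {A B η : ℝ} {N k₀ d₀ : ℕ} {τ : ℝ≥0∞} (hA : 0 ≤ A) (hB : 0 < B)
    (hA' : A ^ 2 ≤ k₀ - η) (hB' : B ^ 2 ≤ d₀ - η)
    (hτ : ∀ j ≤ N, (Measure.pi fun _ : Fin j => gaussianReal 0 1) {g | η < |g ⬝ᵥ g - j|} ≤ τ) :
    ∀ (L k d : ℕ), k₀ + L ≤ k → d₀ + L ≤ d → d ≤ N → k ≤ N →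
      ∀ e : Fin d → ℝ, e ⬝ᵥ e = 1 →
        stdGaussianMatrix k d {G | ∀ z, e ⬝ᵥ z = 1 → z ⬝ᵥ z = L + 1 →
          (G *ᵥ z) ⬝ᵥ (G *ᵥ z) ≤ L * (A + B) ^ 2 - 1} ≤ L * (2 * τ) := by
  intro L
  induction L with
  | zero =>
    intro k d _ _ _ _ e he
    have : {G : Matrix (Fin k) (Fin d) ℝ | ∀ z, e ⬝ᵥ z = 1 → z ⬝ᵥ z = (0 : ℕ) + 1 →
          (G *ᵥ z) ⬝ᵥ (G *ᵥ z) ≤ (0 : ℕ) * (A + B) ^ 2 - 1} = ∅ := by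
      rw [Set.eq_empty_iff_forall_notMem]
      intro G hG
      have h1 := hG e he (by simpa using he)
      have h2 := zero_le_dotProduct_self (G *ᵥ e)
      simp only [Nat.cast_zero, zero_mul] at h1
      linarith
    rw [this]
    simp
  | succ L ih =>
    intro k d hk hd hdN hkN e he
    obtain ⟨k, rfl⟩ : ∃ k', k = k' + 1 := ⟨k - 1, by omega⟩
    obtain ⟨d, rfl⟩ : ∃ d', d = d' + 1 := ⟨d - 1, by omega⟩
    set S : (Fin (d + 1) → ℝ) → Set (Matrix (Fin (k + 1)) (Fin (d + 1)) ℝ) := fun e =>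
      {G | ∀ z, e ⬝ᵥ z = 1 → z ⬝ᵥ z = (L + 1 : ℕ) + 1 →
        (G *ᵥ z) ⬝ᵥ (G *ᵥ z) ≤ (L + 1 : ℕ) * (A + B) ^ 2 - 1} with hS
    have hmeas : ∀ e, MeasurableSet (S e) := by
      intro e
      have : S e = ⋂ z : Fin (d + 1) → ℝ, ⋂ _ : e ⬝ᵥ z = 1, ⋂ _ : z ⬝ᵥ z = (L + 1 : ℕ) + 1,
          {G | (G *ᵥ z) ⬝ᵥ (G *ᵥ z) ≤ (L + 1 : ℕ) * (A + B) ^ 2 - 1} := by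
        ext G
        simp [hS]
      rw [this]
      exact (isClosed_iInter fun z => isClosed_iInter fun _ => isClosed_iInter fun _ =>
        isClosed_le (continuous_mulVec_dotProduct z) continuous_const).measurableSet
    obtain ⟨U, hU, hUe⟩ := exists_orthogonal_mulVec_eq e
    rw [he, Real.sqrt_one] at hUe
    calc stdGaussianMatrix (k + 1) (d + 1) (S e)
        ≤ stdGaussianMatrix (k + 1) (d + 1) (S (Pi.single 0 1)) := by
          refine measure_rotate_le (hmeas _) U hU fun G hG z hz hz' => ?_
          have hUU : U *ᵥ (Uᵀ *ᵥ z) = z := by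
            rw [mulVec_mulVec, mul_eq_one_comm.mp hU, one_mulVec]
          have := hG (Uᵀ *ᵥ z)
            (by rw [← mulVec_dotProduct_mulVec_of_orthogonal hU, hUU, hUe, hz])
            (by rw [← mulVec_dotProduct_mulVec_of_orthogonal hU, hUU, hz'])
          rwa [← mulVec_mulVec, hUU] at this
      _ ≤ _ := measure_le_of_bidiagonal_step (hmeas _) ?_
          {g | η < |g ⬝ᵥ g - (k + 1 : ℕ)|} {r | η < |r ⬝ᵥ r - d|} (p := L * (2 * τ)) ?_
      _ ≤ τ + (τ + L * (2 * τ)) := by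
          gcongr
          · exact hτ _ hkN
          · exact hτ _ (by omega)
      _ = ((L + 1 : ℕ) : ℝ≥0∞) * (2 * τ) := by push_cast; ring
    · intro V hV G hG z hz hz'
      have := hG z hz hz'
      rwa [← mulVec_mulVec, mulVec_dotProduct_mulVec_of_orthogonal hV]
    · intro g hg r hr
      simp only [Set.mem_ofPred_eq, not_lt] at hg hr
      have hkR : (k₀ : ℝ) + L ≤ k := by exact_mod_cast (by omega : k₀ + L ≤ k)
      have hdR : (d₀ : ℝ) + L ≤ d := by exact_mod_cast (by omega : d₀ + L ≤ d)
      have hL0 : (0 : ℝ) ≤ L := Nat.cast_nonneg L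
      push_cast at hg
      rw [abs_le] at hg hr
      have hAa : A ≤ √(g ⬝ᵥ g) := Real.le_sqrt_of_sq_le (by linarith)
      have hBb : B ≤ √(r ⬝ᵥ r) := Real.le_sqrt_of_sq_le (by linarith)
      have hr0 : r ⬝ᵥ r ≠ 0 := (lt_of_lt_of_le (pow_pos hB 2) (by linarith)).ne'
      refine le_trans (measure_mono ?_) (ih k d (by omega) (by omega) (by omega) (by omega) _
        (inv_sqrt_smul_dotProduct_self hr0))
      intro G hG y hy hy'
      have := hG (Fin.cons 1 y) (by rw [single_dotProduct, Fin.cons_zero, one_mul])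
        (by rw [cons_dotProduct_self, hy']; push_cast; ring)
      rw [mulVec_consCol_consRow, dotProduct_eq_sqrt_mul r y, hy] at this
      push_cast at this
      have h2 : (A + B) ^ 2 ≤ (√(g ⬝ᵥ g) * 1 + √(r ⬝ᵥ r) * 1) ^ 2 :=
        pow_le_pow_left₀ (by linarith) (by linarith) 2
      linarith

end SpectralBounds
section Reduction

open scoped MatrixOrder in
lemma exists_eq_mul_of_rank_eq {n d : ℕ} (A : Matrix (Fin n) (Fin d) ℝ) (hA : A.rank = d) :
    ∃ (O : Matrix (Fin n) (Fin d) ℝ) (R : Matrix (Fin d) (Fin d) ℝ),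
      Oᵀ * O = 1 ∧ A = O * R ∧ IsUnit R.det := by
  have hpos : (Aᵀ * A).PosSemidef := by
    simpa using posSemidef_conjTranspose_mul_self A
  set R := CFC.sqrt (Aᵀ * A) with hR
  have hRR : R * R = Aᵀ * A := CFC.sqrt_mul_sqrt_self _ hpos.nonneg
  have hRt : Rᵀ = R := by
    have : IsSelfAdjoint R := (CFC.sqrt_nonneg (Aᵀ * A)).isSelfAdjoint
    simpa [star_eq_conjTranspose] using this.star_eq
  have hunit : IsUnit (Aᵀ * A) := by
    rw [← mulVec_surjective_iff_isUnit]
    have h : (Aᵀ * A).rank = d := (rank_transpose_mul_self A).trans hA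
    have htop : LinearMap.range (Aᵀ * A).mulVecLin = ⊤ :=
      Submodule.eq_top_of_finrank_eq (by rw [← Matrix.rank, h, Module.finrank_fin_fun])
    exact LinearMap.range_eq_top.mp htop
  have hRdet : IsUnit R.det := by
    rw [← hRR, isUnit_iff_isUnit_det, det_mul] at hunit
    exact isUnit_of_mul_isUnit_left hunit
  refine ⟨A * R⁻¹, R, ?_, ?_, hRdet⟩
  · rw [transpose_mul, transpose_nonsing_inv, hRt, Matrix.mul_assoc, ← Matrix.mul_assoc Aᵀ, ← hRR,
      Matrix.mul_assoc R, mul_nonsing_inv R hRdet, Matrix.mul_one, nonsing_inv_mul R hRdet]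
  · rw [Matrix.mul_assoc, nonsing_inv_mul R hRdet, Matrix.mul_one]

lemma measurePreserving_smul_gaussianMatrix {k : ℕ} (n : ℕ) :
    MeasurePreserving (fun S : Matrix (Fin k) (Fin n) ℝ => (√k)⁻¹ • S)
      (stdGaussianMatrix k n) (gaussianMatrix k n) := by
  have h : MeasurePreserving (fun x : ℝ => (√k)⁻¹ * x) (gaussianReal 0 1)
      (gaussianReal 0 (1 / k)) := by
    refine ⟨by fun_prop, ?_⟩
    rw [gaussianReal_map_const_mul]
    congr 1
    · simp
    · ext
      simp
  exact measurePreserving_pi (fun _ : Fin k => Measure.pi fun _ : Fin n => gaussianReal 0 1)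
    (fun _ : Fin k => Measure.pi fun _ : Fin n => gaussianReal 0 (1 / k))
    fun _ => measurePreserving_pi _ _ fun _ => h

lemma gaussianMatrix_isSubspaceEmbedding {k n d : ℕ} (hk : 0 < k)
    (A : Matrix (Fin n) (Fin d) ℝ) (hA : A.rank = d) (ε : ℝ) :
    gaussianMatrix k n {S | IsSubspaceEmbedding S A ε} =
      stdGaussianMatrix k d {G | ∀ y : Fin d → ℝ, (1 - ε) * k * (y ⬝ᵥ y) ≤ (G *ᵥ y) ⬝ᵥ (G *ᵥ y) ∧
        (G *ᵥ y) ⬝ᵥ (G *ᵥ y) ≤ (1 + ε) * k * (y ⬝ᵥ y)} := by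
  obtain ⟨O, R, hO, rfl, hR⟩ := exists_eq_mul_of_rank_eq A hA
  have hk' : (0 : ℝ) < k := by exact_mod_cast hk
  have hemb : ∀ S : Matrix (Fin k) (Fin n) ℝ, IsSubspaceEmbedding S (O * R) ε ↔
      ∀ y : Fin d → ℝ, (1 - ε) * (y ⬝ᵥ y) ≤ ((S * O) *ᵥ y) ⬝ᵥ ((S * O) *ᵥ y) ∧
        ((S * O) *ᵥ y) ⬝ᵥ ((S * O) *ᵥ y) ≤ (1 + ε) * (y ⬝ᵥ y) := by
    intro S
    have hq : ∀ z, ∑ i, ((O * R).mulVec z i) ^ 2 = (R *ᵥ z) ⬝ᵥ (R *ᵥ z) := by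
      intro z
      rw [← mulVec_dotProduct_mulVec_of_orthogonal hO, mulVec_mulVec]
      simp only [dotProduct, sq]
    have hq' : ∀ z, ∑ i, ((S * (O * R)).mulVec z i) ^ 2 =
        ((S * O) *ᵥ (R *ᵥ z)) ⬝ᵥ ((S * O) *ᵥ (R *ᵥ z)) := by
      intro z
      rw [mulVec_mulVec, Matrix.mul_assoc]
      simp only [dotProduct, sq]
    simp only [IsSubspaceEmbedding, hq, hq']
    refine ⟨fun h y => ?_, fun h z => h _⟩
    have := h (R⁻¹ *ᵥ y)
    rwa [mulVec_mulVec, mul_nonsing_inv R hR, one_mulVec] at this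
  have hcl : ∀ {m : ℕ} (T : Matrix (Fin m) (Fin d) ℝ) (a b : ℝ),
      MeasurableSet {S : Matrix (Fin k) (Fin m) ℝ | ∀ y : Fin d → ℝ,
        a * (y ⬝ᵥ y) ≤ ((S * T) *ᵥ y) ⬝ᵥ ((S * T) *ᵥ y) ∧
        ((S * T) *ᵥ y) ⬝ᵥ ((S * T) *ᵥ y) ≤ b * (y ⬝ᵥ y)} := by
    intro m T a b
    have hc : ∀ y, Continuous fun S : Matrix (Fin k) (Fin m) ℝ =>
        ((S * T) *ᵥ y) ⬝ᵥ ((S * T) *ᵥ y) := fun y =>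
      (continuous_mulVec_dotProduct y).comp (continuous_id.matrix_mul continuous_const)
    have : {S : Matrix (Fin k) (Fin m) ℝ | ∀ y : Fin d → ℝ,
        a * (y ⬝ᵥ y) ≤ ((S * T) *ᵥ y) ⬝ᵥ ((S * T) *ᵥ y) ∧
        ((S * T) *ᵥ y) ⬝ᵥ ((S * T) *ᵥ y) ≤ b * (y ⬝ᵥ y)} = ⋂ y : Fin d → ℝ,
        ({S | a * (y ⬝ᵥ y) ≤ ((S * T) *ᵥ y) ⬝ᵥ ((S * T) *ᵥ y)} ∩
        {S | ((S * T) *ᵥ y) ⬝ᵥ ((S * T) *ᵥ y) ≤ b * (y ⬝ᵥ y)}) := by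
      ext S
      simp
    rw [this]
    exact (isClosed_iInter fun y => (isClosed_le continuous_const (hc y)).inter
      (isClosed_le (hc y) continuous_const)).measurableSet
  have h1 := hcl (m := d) 1 ((1 - ε) * k) ((1 + ε) * k)
  simp only [Matrix.mul_one] at h1
  simp only [hemb]
  rw [← (measurePreserving_smul_gaussianMatrix n).measure_preimage (hcl O _ _).nullMeasurableSet,
    ← (measurePreserving_mul_right k O hO).measure_preimage h1.nullMeasurableSet]
  congr 1
  ext S
  refine forall_congr' fun y => ?_
  rw [smul_mul, smul_mulVec, smul_dotProduct, dotProduct_smul, smul_smul, ← mul_inv,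
    Real.mul_self_sqrt hk'.le, smul_eq_mul, inv_mul_eq_div, le_div_iff₀ hk', div_le_iff₀ hk',
    mul_right_comm, mul_right_comm (1 + ε)]

end Reduction

section Asymptotics

lemma tendsto_mul_exp_neg_nat {c : ℝ} (hc : 0 < c) :
    Tendsto (fun N : ℕ => (N : ℝ≥0∞) * (2 * ENNReal.ofReal (2 * Real.exp (-c * N))))
      atTop (nhds 0) := by
  have h : Tendsto (fun N : ℕ => 4 / c * ((c * N) ^ 1 * Real.exp (-(c * N)))) atTop (nhds 0) := by
    have := ((Real.tendsto_pow_mul_exp_neg_atTop_nhds_zero 1).comp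
      (tendsto_natCast_atTop_atTop.const_mul_atTop hc)).const_mul (4 / c)
    simpa using this
  have h' := ENNReal.tendsto_ofReal h
  rw [ENNReal.ofReal_zero] at h'
  refine h'.congr fun N => ?_
  rw [← ENNReal.ofReal_natCast, ← ENNReal.ofReal_ofNat 2, ← ENNReal.ofReal_mul (by norm_num),
    ← ENNReal.ofReal_mul (by positivity)]
  congr 1
  rw [neg_mul]
  field_simp
  ring

lemma tendsto_tail {k d : ℕ → ℕ} (htk : Tendsto k atTop atTop) {δ : ℝ} (hδ : 0 < δ) :
    Tendsto (fun m => ((k m + d m : ℕ) : ℝ≥0∞) *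
      (2 * ENNReal.ofReal (2 * Real.exp (-(δ ^ 2 / 16) * (k m + d m : ℕ))))) atTop (nhds 0) :=
  (tendsto_mul_exp_neg_nat (by positivity)).comp
    (tendsto_atTop_mono (fun m => Nat.le_add_right (k m) (d m)) htk)

lemma eventually_ratio_bounds {k d : ℕ → ℕ} {α t : ℝ} (ht : 0 < t) (htk : Tendsto k atTop atTop)
    (hratio : Tendsto (fun m => (d m : ℝ) / (k m : ℝ)) atTop (nhds α)) :
    ∀ᶠ m in atTop, 0 < k m ∧ (α - t) * k m ≤ d m ∧ (d m : ℝ) ≤ (α + t) * k m := by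
  filter_upwards [htk.eventually_gt_atTop 0, hratio.eventually_const_le (sub_lt_self α ht),
    hratio.eventually_le_const (lt_add_of_pos_right α ht)] with m hk h1 h2
  have hk' : (0 : ℝ) < k m := by exact_mod_cast hk
  exact ⟨hk, (le_div_iff₀ hk').mp h1, (div_le_iff₀ hk').mp h2⟩

lemma exists_small_of_continuous {ι : Type*} [Finite ι] {f : ι → ℝ → ℝ}
    (hf : ∀ i, Continuous (f i)) (h0 : ∀ i, 0 < f i 0) :
    ∃ t : ℝ, 0 < t ∧ t ≤ 1 ∧ ∀ i, 0 < f i t := by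
  have h : ∀ᶠ t in nhdsWithin (0 : ℝ) (Set.Ioi 0), ∀ i, 0 < f i t :=
    eventually_all.mpr fun i =>
      (((hf i).tendsto 0).eventually_const_lt (h0 i)).filter_mono nhdsWithin_le_nhds
  obtain ⟨t, ht, ht0, ht1⟩ := (h.and (Ioc_mem_nhdsGT zero_lt_one)).exists
  exact ⟨t, ht0, ht1, ht⟩

lemma exists_upper_parameters {α ε : ℝ} (hα : 0 < α) (hε : (1 + √α) ^ 2 - 1 < ε) :
    ∃ p t : ℝ, 0 < p ∧ 0 < t ∧ t ≤ 1 ∧ α + t + 2 * (t * (1 + α + t)) + 2 * p ≤ ε ∧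
      (1 + t * (1 + α + t)) * (α + t + t * (1 + α + t)) ≤ p ^ 2 := by
  have hs : √α ^ 2 = α := Real.sq_sqrt hα.le
  have hs0 : 0 < √α := Real.sqrt_pos.mpr hα
  obtain ⟨p, hp1, hp2⟩ := exists_between (show √α < (ε - α) / 2 by nlinarith)
  obtain ⟨t, ht0, ht1, ht⟩ := exists_small_of_continuous
    (f := ![fun t => ε - (α + t + 2 * (t * (1 + α + t)) + 2 * p),
      fun t => p ^ 2 - (1 + t * (1 + α + t)) * (α + t + t * (1 + α + t))])
    (by
      intro i
      fin_cases i <;> simp <;> fun_prop)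
    (by
      intro i
      fin_cases i
      · simp
        linarith
      · simp
        nlinarith)
  have h0 := ht 0
  have h1 := ht 1
  simp only [Matrix.cons_val_zero, Matrix.cons_val_one, sub_pos] at h0 h1
  exact ⟨p, t, hs0.trans hp1, ht0, ht1, h0.le, h1.le⟩

lemma exists_lower_parameters {α ε : ℝ} (hα : 0 < α) (hε : ε < (1 + √α) ^ 2 - 1) :
    ∃ a b t : ℝ, 0 < a ∧ 0 < b ∧ 0 < t ∧ t ≤ 1 ∧ 1 + ε < (a + b) ^ 2 ∧
      a ^ 2 + t * (1 + α + t) + t ≤ 1 ∧ b ^ 2 + t * (1 + α + t) + t ≤ α - t := by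
  have hs : √α ^ 2 = α := Real.sq_sqrt hα.le
  have hs0 : 0 < √α := Real.sqrt_pos.mpr hα
  obtain ⟨u, hu0, -, hu⟩ := exists_small_of_continuous
    (f := ![fun u => (1 - u + (√α - u)) ^ 2 - (1 + ε), fun u => 1 - u, fun u => √α - u])
    (by
      intro i
      fin_cases i <;> simp <;> fun_prop)
    (by
      intro i
      fin_cases i <;> simp <;> linarith)
  have h0 := hu 0
  have h1 := hu 1
  have h2 := hu 2
  simp only [Matrix.cons_val] at h0 h1 h2
  obtain ⟨t, ht0, ht1, ht⟩ := exists_small_of_continuous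
    (f := ![fun t => 1 - ((1 - u) ^ 2 + t * (1 + α + t) + t),
      fun t => α - t - ((√α - u) ^ 2 + t * (1 + α + t) + t)])
    (by
      intro i
      fin_cases i <;> simp <;> fun_prop)
    (by
      intro i
      fin_cases i
      · simpa using (show (1 - u) ^ 2 < 1 by nlinarith)
      · simp
        nlinarith)
  have h3 := ht 0
  have h4 := ht 1
  simp only [Matrix.cons_val_zero, Matrix.cons_val_one, sub_pos] at h3 h4
  exact ⟨1 - u, √α - u, t, h1, h2, ht0, ht1, by linarith, h3.le, by linarith⟩

lemma stdGaussianMatrix_forall_le_le {k d L : ℕ} {α ε a b t : ℝ} (ha : 0 < a)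
    (hb : 0 < b) (ht0 : 0 < t) (ht1 : t ≤ 1) (hk : 0 < k) (hd : 0 < d)
    (hL : 2 + ε ≤ L * ((a + b) ^ 2 - (1 + ε))) (hLk : L ≤ k) (hLd : L ≤ d)
    (hLt : (L : ℝ) ≤ t * k)
    (h1 : a ^ 2 + t * (1 + α + t) + t ≤ 1) (h2 : b ^ 2 + t * (1 + α + t) + t ≤ α - t)
    (hd1 : (α - t) * k ≤ d) (hd2 : d ≤ (α + t) * k) :
    stdGaussianMatrix k d {G | ∀ y : Fin d → ℝ, (1 - ε) * k * (y ⬝ᵥ y) ≤ (G *ᵥ y) ⬝ᵥ (G *ᵥ y) ∧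
        (G *ᵥ y) ⬝ᵥ (G *ᵥ y) ≤ (1 + ε) * k * (y ⬝ᵥ y)} ≤
      L * (2 * ENNReal.ofReal (2 * Real.exp (-(t ^ 2 / 16) * (k + d : ℕ)))) := by
  have hk1 : (1 : ℝ) ≤ k := by exact_mod_cast hk
  have hk0 : (0 : ℝ) < k := by linarith
  have hsk : √(k : ℝ) ^ 2 = k := Real.sq_sqrt hk0.le
  have hη : t * (k + d : ℕ) ≤ t * (1 + α + t) * k := by
    push_cast
    nlinarith
  refine (measure_mono ?_).trans (measure_forall_le_le (A := a * √k) (B := b * √k)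
    (η := t * (k + d : ℕ)) (N := k + d) (k₀ := k - L) (d₀ := d - L) (by positivity)
    (by positivity) ?_ ?_ (fun j hj => dotProduct_self_concentration ht0 ht1 hj) L k d (by lia)
    (by lia) (by lia) (by lia) (Pi.single ⟨0, hd⟩ 1) (by simp))
  · intro G hG z _ hz
    refine (hG z).2.trans ?_
    rw [hz, ← add_mul, mul_pow, hsk]
    nlinarith
  · rw [mul_pow, hsk, Nat.cast_sub hLk]
    nlinarith
  · rw [mul_pow, hsk, Nat.cast_sub hLd]
    nlinarith

lemma stdGaussianMatrix_compl_forall_le_le {k d : ℕ} {α ε p t : ℝ} (hp : 0 < p) (ht0 : 0 < t)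
    (ht1 : t ≤ 1) (hα : 0 < α) (h1 : α + t + 2 * (t * (1 + α + t)) + 2 * p ≤ ε)
    (h2 : (1 + t * (1 + α + t)) * (α + t + t * (1 + α + t)) ≤ p ^ 2)
    (hd2 : d ≤ (α + t) * k) :
    stdGaussianMatrix k d {G | ∀ y : Fin d → ℝ, (1 - ε) * k * (y ⬝ᵥ y) ≤ (G *ᵥ y) ⬝ᵥ (G *ᵥ y) ∧
        (G *ᵥ y) ⬝ᵥ (G *ᵥ y) ≤ (1 + ε) * k * (y ⬝ᵥ y)}ᶜ ≤
      (k + d : ℕ) * (2 * ENNReal.ofReal (2 * Real.exp (-(t ^ 2 / 16) * (k + d : ℕ)))) := by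
  have hk0 : (0 : ℝ) ≤ k := by positivity
  have hη : t * (k + d : ℕ) ≤ t * (1 + α + t) * k := by
    push_cast
    nlinarith
  have key := measure_deviationSet_le (K := k) (M := ε * k) (P := p * k) (D := d)
    (η := t * (k + d : ℕ)) (N := k + d) (by positivity) (by positivity) ?_ ?_
    (fun j hj => dotProduct_self_concentration ht0 ht1 hj) d k (by lia) (by lia) le_rfl
    (add_comm _ _) 0 (by simp)
  · refine (measure_mono ?_).trans (key.trans ?_)
    · intro G hG
      simp only [Set.mem_compl_iff, Set.mem_ofPred_eq, not_forall] at hG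
      obtain ⟨z, hz⟩ := hG
      refine ⟨z, ?_⟩
      rw [zero_dotProduct]
      by_contra! h
      have := abs_le.mp h
      exact hz ⟨by linarith, by linarith⟩
    · gcongr
      lia
  · calc ((k : ℝ) + t * (k + d : ℕ)) * (d + t * (k + d : ℕ))
        ≤ (k + t * (1 + α + t) * k) * ((α + t) * k + t * (1 + α + t) * k) := by gcongr
      _ = (1 + t * (1 + α + t)) * (α + t + t * (1 + α + t)) * k ^ 2 := by ring
      _ ≤ p ^ 2 * k ^ 2 := by gcongr
      _ = (p * k) ^ 2 := by ring
  · nlinarith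

end Asymptotics

/-- For Gaussian sketches `S_m` of size `k_m × n_m` applied to rank-`d_m` data matrices
`A_m` (`n_m > d_m`), with `d_m, k_m → ∞` and `d_m / k_m → α ∈ (0, 1]`: for every
`ε > 0` with `ε ≠ (1 + √α)² − 1`, the probability of obtaining an `ε`-subspace
embedding tends to `0` if `ε < (1 + √α)² − 1`, and to `1` if `ε > (1 + √α)² − 1`. -/
theorem gaussian_embedding_probability_zero_one_law
    (k d n : ℕ → ℕ) (α : ℝ) (hα0 : 0 < α) (hα1 : α ≤ 1)
    (hdn : ∀ m, d m < n m)
    (htd : Tendsto (fun m => d m) atTop atTop)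
    (htk : Tendsto (fun m => k m) atTop atTop)
    (hratio : Tendsto (fun m => (d m : ℝ) / (k m : ℝ)) atTop (nhds α))
    (A : ∀ m, Matrix (Fin (n m)) (Fin (d m)) ℝ) (hrank : ∀ m, (A m).rank = d m)
    (ε : ℝ) (hε : 0 < ε) (hne : ε ≠ (1 + Real.sqrt α) ^ 2 - 1) :
    (ε < (1 + Real.sqrt α) ^ 2 - 1 →
      Tendsto (fun m => gaussianMatrix (k m) (n m) {S | IsSubspaceEmbedding S (A m) ε})
        atTop (nhds 0)) ∧
    ((1 + Real.sqrt α) ^ 2 - 1 < ε →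
      Tendsto (fun m => gaussianMatrix (k m) (n m) {S | IsSubspaceEmbedding S (A m) ε})
        atTop (nhds 1)) := by
  have hm {P : ℝ≥0∞ → Prop} {m : ℕ} (hk : 0 < k m)
      (h : P (stdGaussianMatrix (k m) (d m) {G | ∀ y : Fin (d m) → ℝ,
        (1 - ε) * k m * (y ⬝ᵥ y) ≤ (G *ᵥ y) ⬝ᵥ (G *ᵥ y) ∧
        (G *ᵥ y) ⬝ᵥ (G *ᵥ y) ≤ (1 + ε) * k m * (y ⬝ᵥ y)})) :
      P (gaussianMatrix (k m) (n m) {S | IsSubspaceEmbedding S (A m) ε}) := by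
    rwa [gaussianMatrix_isSubspaceEmbedding hk (A m) (hrank m)]
  constructor
  · intro hlt
    obtain ⟨a, b, t, ha, hb, ht0, ht1, hab, h1, h2⟩ := exists_lower_parameters hα0 hlt
    obtain ⟨L, hL⟩ := exists_nat_ge ((2 + ε) / ((a + b) ^ 2 - (1 + ε)))
    rw [div_le_iff₀ (sub_pos.mpr hab)] at hL
    refine tendsto_of_tendsto_of_tendsto_of_le_of_le' tendsto_const_nhds
      (tendsto_tail (d := d) htk ht0) (Eventually.of_forall fun _ => zero_le) ?_
    filter_upwards [eventually_ratio_bounds ht0 htk hratio, htk.eventually_ge_atTop L,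
      htd.eventually_ge_atTop L, htd.eventually_gt_atTop 0,
      (tendsto_natCast_atTop_atTop.comp htk).eventually_ge_atTop ((L : ℝ) / t)]
      with m ⟨hk, hd1, hd2⟩ hLk hLd hd hLt
    refine hm (P := (· ≤ _)) hk ((stdGaussianMatrix_forall_le_le ha hb ht0 ht1 hk hd hL hLk hLd
      ?_ h1 h2 hd1 hd2).trans ?_)
    · rw [mul_comm]
      exact (div_le_iff₀ ht0).mp hLt
    · gcongr
      lia
  · intro hlt
    obtain ⟨p, t, hp, ht0, ht1, h1, h2⟩ := exists_upper_parameters hα0 hlt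
    have hsub := ENNReal.Tendsto.sub (tendsto_const_nhds (x := (1 : ℝ≥0∞)))
      (tendsto_tail (d := d) htk ht0) (Or.inl ENNReal.one_ne_top)
    rw [tsub_zero] at hsub
    refine tendsto_of_tendsto_of_tendsto_of_le_of_le' hsub tendsto_const_nhds ?_
      (Eventually.of_forall fun _ => prob_le_one)
    filter_upwards [eventually_ratio_bounds ht0 htk hratio] with m ⟨hk, _, hd2⟩
    refine hm (P := (_ ≤ ·)) hk (tsub_le_iff_right.mpr ?_)
    refine le_trans ?_ (add_le_add_right
      (stdGaussianMatrix_compl_forall_le_le hp ht0 ht1 hα0 h1 h2 hd2) _)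
    rw [← measure_univ (μ := stdGaussianMatrix (k m) (d m)), ← Set.union_compl_self]
    exact measure_union_le _ _
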